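/- Assume r ≥ 2 and d ≥ 3. Let t be a positive integer with 2t < 3d, and let f be a nonzero homogeneous polynomial of degree d in x_0,…,x_r over K with sr(f) = t. Let A ∈ S(f) and suppose there is a line D = ℙ(W) of ℙ^r, where W is a 2-dimensional subspace of the space of linear forms, with n := #(A ∩ D) ≥ ⌈(d+2)/2⌉; set F := A ∖ D. Then: the subspace span{ℓ^d : ℓ ∈ A ∩ D} ∩ span({f} ∪ {ℓ^d : ℓ ∈ F}) is one-dimensional; letting g be a generator of it, sr(g) = n; S(g) is infinite; every decomposition E ∈ S(g) consists of linear forms lying in W (hence is disjoint from F as a set of points of ℙ^r); and for every E ∈ S(g) the set E ∪ F is a decomposition of f. -/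

import Mathlib

open MvPolynomial

/-- The degree-`d` power of (a representative linear form of) a point of `ℙ^r`,
regarded as a homogeneous polynomial of degree `d` in `x_0, …, x_r`. -/
noncomputable def powForm (K : Type) [Field K] (r d : ℕ)
    (p : Projectivization K (Fin (r + 1) → K)) : MvPolynomial (Fin (r + 1)) K :=
  (∑ i, MvPolynomial.C (p.rep i) * MvPolynomial.X i) ^ d

/-- The span of the `d`-th powers of the linear forms corresponding to a set of
points of `ℙ^r`. -/
noncomputable def decompSpan (K : Type) [Field K] (r d : ℕ)
    (S : Set (Projectivization K (Fin (r + 1) → K))) :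
    Submodule K (MvPolynomial (Fin (r + 1)) K) :=
  Submodule.span K (powForm K r d '' S)

/-- The symmetric rank of `f`. -/
noncomputable def symRank (K : Type) [Field K] (r d : ℕ)
    (f : MvPolynomial (Fin (r + 1)) K) : ℕ :=
  sInf {n | ∃ A : Finset (Projectivization K (Fin (r + 1) → K)),
    A.card = n ∧ f ∈ decompSpan K r d ↑A}

/-- `S(f)`: the set of decompositions of `f`, i.e. finite sets of points of `ℙ^r`
computing the symmetric rank of `f`. -/
def decompSet (K : Type) [Field K] (r d : ℕ) (f : MvPolynomial (Fin (r + 1)) K) :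
    Set (Finset (Projectivization K (Fin (r + 1) → K))) :=
  {A | f ∈ decompSpan K r d ↑A ∧ A.card = symRank K r d f}

/-- The points of `ℙ^r` lying on the hypersurface `Z(q)`. -/
def projZeros (K : Type) [Field K] (r : ℕ) (q : MvPolynomial (Fin (r + 1)) K) :
    Set (Projectivization K (Fin (r + 1) → K)) :=
  {p | MvPolynomial.eval p.rep q = 0}

/-- A line of `ℙ^r`. -/
def IsProjLine (K : Type) [Field K] (r : ℕ)
    (L : Set (Projectivization K (Fin (r + 1) → K))) : Prop :=
  ∃ W : Submodule K (Fin (r + 1) → K), Module.finrank K W = 2 ∧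
    L = {p | p.rep ∈ W}

/-- A smooth conic of `ℙ^r`. -/
def IsSmoothConic (K : Type) [Field K] (r : ℕ)
    (C : Set (Projectivization K (Fin (r + 1) → K))) : Prop :=
  ∃ u v w : Fin (r + 1) → K, LinearIndependent K ![u, v, w] ∧
    C = {p | ∃ s t : K, (s ≠ 0 ∨ t ≠ 0) ∧
      p.submodule = Submodule.span K {s ^ 2 • u + (s * t) • v + t ^ 2 • w}}

theorem exists_degreeLT_ne_zero_apolar {K : Type} [Field K] (β : Finset K) (c : K → K) (d : ℕ)
    (h : d + 2 ≤ 2 * β.card) :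
    ∃ P : Polynomial K, P ≠ 0 ∧ P.degree < β.card ∧
      ∀ k < d + 1 - β.card, ∑ x ∈ β, c x * (P * Polynomial.X ^ k).eval x = 0 := by
  let L : Polynomial.degreeLT K β.card →ₗ[K] (Fin (d + 1 - β.card) → K) :=
    LinearMap.pi fun k => ∑ x ∈ β, c x • (Polynomial.leval x ∘ₗ
      LinearMap.mulRight K (Polynomial.X ^ (k : ℕ)) ∘ₗ (Polynomial.degreeLT K β.card).subtype)
  have hfin : Module.Finite K (Polynomial.degreeLT K β.card) :=
    Module.Finite.equiv (Polynomial.degreeLTEquiv K β.card).symm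
  have hker : LinearMap.ker L ≠ ⊥ := by
    apply LinearMap.ker_ne_bot_of_finrank_lt
    rw [(Polynomial.degreeLTEquiv K β.card).finrank_eq]
    simp only [Module.finrank_fin_fun]
    omega
  obtain ⟨P, hP, hP0⟩ := (Submodule.ne_bot_iff _).1 hker
  refine ⟨P, by simpa using hP0, Polynomial.mem_degreeLT.1 P.2, fun k hk => ?_⟩
  have := congrFun (LinearMap.mem_ker.1 hP) ⟨k, hk⟩
  simpa [L] using this

theorem finite_setOf_not_nodup_roots_add_C_mul {K : Type} [Field K]
    {Q P : Polynomial K} (hQ : Q.Separable) (hP0 : P ≠ 0) (hdeg : P.degree < Q.degree) :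
    {s : K | ¬ (Q + Polynomial.C s * P).roots.Nodup}.Finite := by
  classical
  set N := Polynomial.derivative Q * P - Q * Polynomial.derivative P with hN
  have hN0 : N ≠ 0 := by
    intro h
    have h1 : Q ∣ Polynomial.derivative Q * P :=
      ⟨Polynomial.derivative P, sub_eq_zero.1 (hN ▸ h)⟩
    have h2 : Q ∣ P := IsCoprime.dvd_of_dvd_mul_left hQ h1
    exact absurd (Polynomial.degree_le_of_dvd h2 hP0) (not_le.2 hdeg)
  have key : ∀ s : K, ¬ (Q + Polynomial.C s * P).roots.Nodup → ∃ x,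
      Q.eval x + s * P.eval x = 0 ∧
      (Polynomial.derivative Q).eval x + s * (Polynomial.derivative P).eval x = 0 := by
    intro s hs
    have hne : Q + Polynomial.C s * P ≠ 0 := by
      intro h0
      rw [h0] at hs
      simp at hs
    rw [Multiset.nodup_iff_count_le_one] at hs
    push Not at hs
    obtain ⟨x, hx⟩ := hs
    rw [Polynomial.count_roots, Polynomial.one_lt_rootMultiplicity_iff_isRoot hne] at hx
    exact ⟨x, by simpa using hx.1, by simpa using hx.2⟩
  choose! x hx1 hx2 using key
  refine Set.Finite.of_finite_image (f := x)
    ((N.roots.toFinset.finite_toSet).subset ?_) ?_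
  · rintro _ ⟨s, hs, rfl⟩
    have h1 := hx1 s hs
    have h2 := hx2 s hs
    rw [Finset.mem_coe, Multiset.mem_toFinset, Polynomial.mem_roots hN0,
      Polynomial.IsRoot.def, hN, Polynomial.eval_sub, Polynomial.eval_mul, Polynomial.eval_mul]
    linear_combination (P.eval (x s)) * h2 - ((Polynomial.derivative P).eval (x s)) * h1
  · intro s hs s' hs' hss
    by_contra hne
    have h1 := hx1 s hs
    have h2 := hx2 s hs
    have h1' := hx1 s' hs'
    have h2' := hx2 s' hs'
    rw [← hss] at h1' h2'
    have hsub : s - s' ≠ 0 := sub_ne_zero.2 hne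
    have hPx : P.eval (x s) = 0 := by
      apply (mul_eq_zero.1 (_ : (s - s') * _ = 0)).resolve_left hsub
      linear_combination h1 - h1'
    have hP'x : (Polynomial.derivative P).eval (x s) = 0 := by
      apply (mul_eq_zero.1 (_ : (s - s') * _ = 0)).resolve_left hsub
      linear_combination h2 - h2'
    obtain ⟨a, b, hab⟩ := hQ
    have := congrArg (Polynomial.eval (x s)) hab
    rw [hPx, mul_zero, add_zero] at h1
    rw [hP'x, mul_zero, add_zero] at h2
    simp [h1, h2] at this

theorem exists_weights_of_apolar {K : Type} [Field K] (β Γ : Finset K) (c : K → K) (d : ℕ)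
    (h : ∀ k < d + 1 - Γ.card,
      ∑ x ∈ β, c x * ((∏ y ∈ Γ, (Polynomial.X - Polynomial.C y)) * Polynomial.X ^ k).eval x = 0) :
    ∃ w : K → K, ∀ k ≤ d, ∑ x ∈ Γ, w x * x ^ k = ∑ x ∈ β, c x * x ^ k := by
  classical
  set Q : Polynomial K := ∏ y ∈ Γ, (Polynomial.X - Polynomial.C y) with hQ
  have hQm : Q.Monic := Polynomial.monic_prod_of_monic _ _ fun y _ => Polynomial.monic_X_sub_C y
  have hQn : Q.natDegree = Γ.card := by simp [hQ]
  let L : Polynomial K →ₗ[K] K := ∑ x ∈ β, c x • Polynomial.leval x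
  have hL : ∀ p, L p = ∑ x ∈ β, c x * p.eval x := fun p => by simp [L]
  refine ⟨fun y => L (Lagrange.basis Γ id y), fun k hk => ?_⟩
  set p : Polynomial K := Polynomial.X ^ k with hp
  have hquot : L (Q * (p /ₘ Q)) = 0 := by
    by_cases hq : p /ₘ Q = 0
    · simp [hq]
    have hdeg : (p /ₘ Q).natDegree < d + 1 - Γ.card := by
      have h1 : Q.degree ≤ p.degree := by
        by_contra hlt
        exact hq ((Polynomial.divByMonic_eq_zero_iff hQm).2 (not_le.1 hlt))
      have h2 := Polynomial.natDegree_le_natDegree h1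
      rw [Polynomial.natDegree_divByMonic _ hQm, hQn]
      rw [hQn, hp, Polynomial.natDegree_X_pow] at h2
      rw [hp, Polynomial.natDegree_X_pow]
      omega
    rw [(p /ₘ Q).as_sum_range_C_mul_X_pow, Finset.mul_sum, map_sum]
    refine Finset.sum_eq_zero fun i hi => ?_
    rw [mul_left_comm, ← Polynomial.smul_eq_C_mul, map_smul, hL, h i, smul_zero]
    rw [Finset.mem_range] at hi
    omega
  have hrem : p %ₘ Q = ∑ y ∈ Γ, Polynomial.C (y ^ k) * Lagrange.basis Γ id y := by
    have hlt : (p %ₘ Q).degree < Γ.card := by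
      rw [← hQn, ← Polynomial.degree_eq_natDegree hQm.ne_zero]
      exact Polynomial.degree_modByMonic_lt _ hQm
    rw [Lagrange.eq_interpolate (Function.injective_id.injOn) hlt, Lagrange.interpolate_apply]
    refine Finset.sum_congr rfl fun y hy => ?_
    have hy0 : Q.eval y = 0 := by
      rw [hQ, Polynomial.eval_prod]
      exact Finset.prod_eq_zero hy (by simp)
    have := congrArg (Polynomial.eval y) (Polynomial.modByMonic_add_div p Q)
    simp only [Polynomial.eval_add, Polynomial.eval_mul, hy0, zero_mul, add_zero] at this
    rw [id, this, hp, Polynomial.eval_pow, Polynomial.eval_X]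
  have hLp : L p = ∑ x ∈ β, c x * x ^ k := by simp [hL, hp]
  rw [← hLp, ← Polynomial.modByMonic_add_div p Q, map_add, hquot, add_zero, hrem, map_sum]
  refine Finset.sum_congr rfl fun y _ => ?_
  rw [← Polynomial.smul_eq_C_mul, map_smul, smul_eq_mul, mul_comm]

theorem infinite_setOf_quadrature {K : Type} [Field K] [IsAlgClosed K] (β : Finset K)
    (c : K → K) (d : ℕ) (h : d + 2 ≤ 2 * β.card) :
    {Γ : Finset K | Γ.card = β.card ∧
      ∃ w : K → K, ∀ k ≤ d, ∑ x ∈ Γ, w x * x ^ k = ∑ x ∈ β, c x * x ^ k}.Infinite := by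
  classical
  obtain ⟨P, hP0, hPdeg, hP⟩ := exists_degreeLT_ne_zero_apolar β c d h
  set Q : Polynomial K := ∏ y ∈ β, (Polynomial.X - Polynomial.C y) with hQ
  have hQm : Q.Monic := Polynomial.monic_prod_of_monic _ _ fun y _ => Polynomial.monic_X_sub_C y
  have hQn : Q.degree = β.card := by
    rw [Polynomial.degree_eq_natDegree hQm.ne_zero]; simp [hQ]
  have hQs : Q.Separable := Polynomial.separable_prod_X_sub_C_iff'.2 fun x _ y _ hxy => hxy
  have hCdeg : ∀ s : K, (Polynomial.C s * P).degree < Q.degree := fun s => by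
    rw [hQn, ← Polynomial.smul_eq_C_mul]
    exact (Polynomial.degree_smul_le s P).trans_lt hPdeg
  have hmon : ∀ s : K, (Q + Polynomial.C s * P).Monic := fun s =>
    hQm.add_of_left (hCdeg s)
  have hdeg : ∀ s : K, (Q + Polynomial.C s * P).natDegree = β.card := fun s =>
    Polynomial.natDegree_eq_of_degree_eq_some
      ((Polynomial.degree_add_eq_left_of_degree_lt (hCdeg s)).trans hQn)
  have hgood := (finite_setOf_not_nodup_roots_add_C_mul hQs hP0 (hQn ▸ hPdeg)).infinite_compl
  have hprod : ∀ s : K, (Q + Polynomial.C s * P).roots.Nodup →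
      ∏ y ∈ (Q + Polynomial.C s * P).roots.toFinset, (Polynomial.X - Polynomial.C y)
        = Q + Polynomial.C s * P := fun s hs => by
    conv_rhs => rw [(IsAlgClosed.splits _).eq_prod_roots_of_monic (hmon s)]
    rw [Finset.prod_eq_multiset_prod, Multiset.toFinset_val, hs.dedup]
  refine (hgood.image (f := fun s => (Q + Polynomial.C s * P).roots.toFinset) ?_).mono ?_
  · intro s hs s' hs' hss
    simp only [Set.mem_compl_iff, Set.mem_ofPred_eq, not_not] at hs hs'
    have h1 := hprod s hs
    have h2 : s • P = s' • P := by
      rw [show (Q + Polynomial.C s * P).roots.toFinset = _ from hss, hprod s' hs'] at h1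
      simpa [Polynomial.smul_eq_C_mul] using h1.symm
    exact smul_left_injective K hP0 h2
  · rintro _ ⟨s, hs, rfl⟩
    simp only [Set.mem_compl_iff, Set.mem_ofPred_eq, not_not] at hs
    have hcard : (Q + Polynomial.C s * P).roots.toFinset.card = β.card := by
      rw [Multiset.toFinset_card_of_nodup hs, ← hdeg s]
      exact (IsAlgClosed.splits _).natDegree_eq_card_roots.symm
    refine ⟨hcard, exists_weights_of_apolar β _ c d fun k hk => ?_⟩
    rw [hcard] at hk
    have hz : ∑ x ∈ β, c x * (Q * Polynomial.X ^ k).eval x = 0 :=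
      Finset.sum_eq_zero fun x hx => by
        have : Q.eval x = 0 := by
          rw [hQ, Polynomial.eval_prod]
          exact Finset.prod_eq_zero hx (by simp)
        simp [this]
    have hz' := hP k hk
    have : ∑ x ∈ β, c x * ((Q + Polynomial.C s * P) * Polynomial.X ^ k).eval x =
        (∑ x ∈ β, c x * (Q * Polynomial.X ^ k).eval x) +
          s * ∑ x ∈ β, c x * (P * Polynomial.X ^ k).eval x := by
      rw [Finset.mul_sum, ← Finset.sum_add_distrib]
      refine Finset.sum_congr rfl fun x _ => ?_
      simp only [Polynomial.eval_mul, Polynomial.eval_add, Polynomial.eval_C]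
      ring
    rw [hprod s hs, this, hz, hz', mul_zero, add_zero]

/-- The linear form with a given coefficient vector. -/
noncomputable def linForm (K : Type) [Field K] (r : ℕ) :
    (Fin (r + 1) → K) →ₗ[K] MvPolynomial (Fin (r + 1)) K :=
  Fintype.linearCombination K MvPolynomial.X

theorem powForm_eq_linForm_pow {K : Type} [Field K] {r d : ℕ}
    (p : Projectivization K (Fin (r + 1) → K)) :
    powForm K r d p = linForm K r p.rep ^ d := by
  simp [powForm, linForm, Fintype.linearCombination_apply, MvPolynomial.smul_eq_C_mul]

theorem linForm_pow_mem_decompSpan {K : Type} [Field K] {r d : ℕ}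
    {S : Set (Projectivization K (Fin (r + 1) → K))} {v : Fin (r + 1) → K} (hv : v ≠ 0)
    (h : Projectivization.mk K v hv ∈ S) : linForm K r v ^ d ∈ decompSpan K r d S := by
  obtain ⟨a, ha⟩ := Projectivization.exists_smul_eq_mk_rep K v hv
  have hv' : v = (↑a⁻¹ : K) • (Projectivization.mk K v hv).rep := by
    rw [← ha, ← Units.smul_def, inv_smul_smul]
  have : linForm K r v ^ d = ((↑a⁻¹ : K) ^ d) • powForm K r d (Projectivization.mk K v hv) := by
    rw [powForm_eq_linForm_pow, ← smul_pow, ← map_smul, ← hv']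
  rw [this]
  exact Submodule.smul_mem _ _ (Submodule.subset_span ⟨_, h, rfl⟩)

theorem symRank_le_card {K : Type} [Field K] {r d : ℕ} {f : MvPolynomial (Fin (r + 1)) K}
    {A : Finset (Projectivization K (Fin (r + 1) → K))} (h : f ∈ decompSpan K r d ↑A) :
    symRank K r d f ≤ A.card :=
  Nat.sInf_le ⟨A, rfl, h⟩

theorem exists_card_eq_symRank {K : Type} [Field K] {r d : ℕ}
    {f : MvPolynomial (Fin (r + 1)) K}
    {A : Finset (Projectivization K (Fin (r + 1) → K))} (h : f ∈ decompSpan K r d ↑A) :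
    ∃ E : Finset (Projectivization K (Fin (r + 1) → K)),
      E.card = symRank K r d f ∧ f ∈ decompSpan K r d ↑E :=
  Nat.sInf_mem (s := {n | ∃ A : Finset (Projectivization K (Fin (r + 1) → K)),
    A.card = n ∧ f ∈ decompSpan K r d ↑A}) ⟨_, A, rfl, h⟩

theorem linearIndepOn_powForm_of_mem_decompSet {K : Type} [Field K] {r d : ℕ}
    {f : MvPolynomial (Fin (r + 1)) K}
    {A : Finset (Projectivization K (Fin (r + 1) → K))} (hA : A ∈ decompSet K r d f) :
    LinearIndepOn K (powForm K r d) (A : Set (Projectivization K (Fin (r + 1) → K))) := by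
  classical
  rw [linearIndepOn_iff_notMem_span]
  intro a ha hmem
  rw [← Finset.coe_erase] at hmem
  have hle : decompSpan K r d (A : Set (Projectivization K (Fin (r + 1) → K))) ≤
      decompSpan K r d ↑(A.erase a) := by
    refine Submodule.span_le.2 ?_
    rintro _ ⟨p, hp, rfl⟩
    by_cases hpa : p = a
    · exact hpa ▸ hmem
    · exact Submodule.subset_span ⟨p, by simpa [hpa] using hp, rfl⟩
  have h1 := symRank_le_card (hle hA.1)
  have h2 := Finset.card_erase_lt_of_mem (Finset.mem_coe.1 ha)
  have h3 := hA.2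
  omega

theorem rep_mem_of_mem_decompSet {K : Type} [Field K] {r d : ℕ} (hd : d ≠ 0)
    {g : MvPolynomial (Fin (r + 1)) K} {W : Submodule K (Fin (r + 1) → K)}
    (hg : g ∈ decompSpan K r d {p | p.rep ∈ W})
    {E : Finset (Projectivization K (Fin (r + 1) → K))} (hE : E ∈ decompSet K r d g)
    {e : Projectivization K (Fin (r + 1) → K)} (he : e ∈ E) : e.rep ∈ W := by
  classical
  by_contra heW
  obtain ⟨φ, hφe, hφW⟩ := Submodule.exists_le_ker_of_notMem heW
  let π : (Fin (r + 1) → K) →ₗ[K] (Fin (r + 1) → K) :=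
    LinearMap.id - ((φ e.rep)⁻¹ • φ).smulRight e.rep
  have hπW : ∀ w ∈ W, π w = w := fun w hw => by
    simp [π, LinearMap.mem_ker.1 (hφW hw)]
  have hπe : π e.rep = 0 := by simp [π, hφe]
  let T : MvPolynomial (Fin (r + 1)) K →ₐ[K] MvPolynomial (Fin (r + 1)) K :=
    MvPolynomial.aeval fun i => linForm K r (π (Pi.single i 1))
  have hT : ∀ v, T (linForm K r v) = linForm K r (π v) := by
    have : T.toLinearMap ∘ₗ linForm K r = linForm K r ∘ₗ π := by
      refine LinearMap.pi_ext' fun i => LinearMap.ext_ring ?_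
      simp [T, linForm, Fintype.linearCombination_apply_single]
    exact fun v => LinearMap.congr_fun this v
  have hTg : T g = g := by
    have : Set.EqOn T.toLinearMap (LinearMap.id (R := K))
        (decompSpan K r d {p | p.rep ∈ W} : Set (MvPolynomial (Fin (r + 1)) K)) := by
      refine LinearMap.eqOn_span ?_
      rintro _ ⟨p, hp, rfl⟩
      simp [powForm_eq_linForm_pow, hT, hπW _ hp]
    exact this hg
  let m : Projectivization K (Fin (r + 1) → K) → Projectivization K (Fin (r + 1) → K) :=
    fun p => if h : π p.rep ≠ 0 then Projectivization.mk K _ h else p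
  have hmem : g ∈ decompSpan K r d ↑((E.erase e).image m) := by
    have hle : (decompSpan K r d (E : Set (Projectivization K (Fin (r + 1) → K)))).map
        T.toLinearMap ≤ decompSpan K r d ↑((E.erase e).image m) := by
      rw [decompSpan, Submodule.map_span, Submodule.span_le]
      rintro _ ⟨_, ⟨p, hp, rfl⟩, rfl⟩
      simp only [AlgHom.toLinearMap_apply, powForm_eq_linForm_pow, map_pow, hT, SetLike.mem_coe]
      by_cases hp0 : π p.rep = 0
      · rw [hp0, map_zero, zero_pow hd]
        exact Submodule.zero_mem _
      · have hpe : p ≠ e := fun h => hp0 (h ▸ hπe)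
        refine linForm_pow_mem_decompSpan hp0 ?_
        simp only [Finset.coe_image]
        exact ⟨p, by simpa [hpe] using hp, by simp [m, hp0]⟩
    rw [← hTg]
    exact hle (Submodule.mem_map_of_mem (f := T.toLinearMap) hE.1)
  have h1 := symRank_le_card hmem
  have h2 := Finset.card_image_le (s := E.erase e) (f := m)
  have h3 := Finset.card_erase_lt_of_mem he
  have h4 := hE.2
  omega

theorem exists_affine_parametrization {K : Type} [Field K] [Infinite K] {V : Type}
    [AddCommGroup V] [Module K V] {W : Submodule K V} (hW : Module.finrank K W = 2)
    {B : Finset (Projectivization K V)} (hB : ∀ p ∈ B, p.rep ∈ W) (hB0 : B.Nonempty) :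
    ∃ u v : V, LinearIndependent K ![u, v] ∧
      ∀ p ∈ B, ∃ a b : K, a ≠ 0 ∧ p.rep = a • (u + b • v) := by
  obtain ⟨φ, hφ⟩ := Module.exists_dual_forall_apply_ne_zero (K := K)
    (fun p : B => (p : Projectivization K V).rep) fun p => p.1.rep_nonzero
  obtain ⟨p₀, hp₀⟩ := hB0
  set u := (φ p₀.rep)⁻¹ • p₀.rep with hu
  have hφu : φ u = 1 := by simp [hu, hφ ⟨p₀, hp₀⟩]
  have huW : u ∈ W := W.smul_mem _ (hB _ hp₀)
  have hWle : ¬ W ≤ Submodule.span K {u} := fun hle => by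
    have h1 := Submodule.finrank_mono hle
    have h2 := finrank_span_le_card (R := K) ({u} : Set V)
    simp only [Set.toFinset_singleton, Finset.card_singleton] at h2
    omega
  obtain ⟨v', hv'W, hv'⟩ := SetLike.not_le_iff_exists.1 hWle
  set v := v' - φ v' • u with hv
  have hφv : φ v = 0 := by simp [hv, hφu]
  have hvW : v ∈ W := W.sub_mem hv'W (W.smul_mem _ huW)
  have hv0 : v ≠ 0 := fun h0 => hv' (by
    rw [sub_eq_zero.1 (hv.symm.trans h0)]
    exact Submodule.smul_mem _ _ (Submodule.mem_span_singleton_self u))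
  have hli : LinearIndependent K ![u, v] := by
    rw [LinearIndependent.pair_iff]
    intro s t hst
    have hs : s = 0 := by simpa [hφu, hφv] using congrArg φ hst
    refine ⟨hs, ?_⟩
    simpa [hs, hv0] using hst
  have hspan : Submodule.span K (Set.range ![u, v]) = W := by
    have hfin : Module.Finite K W := Module.finite_of_finrank_eq_succ hW
    refine Submodule.eq_of_le_of_finrank_eq ?_ ?_
    · rw [Submodule.span_le]
      rintro _ ⟨i, rfl⟩
      fin_cases i
      · exact huW
      · exact hvW
    · rw [finrank_span_eq_card hli, hW, Fintype.card_fin]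
  refine ⟨u, v, hli, fun p hp => ?_⟩
  have hpW := hB p hp
  rw [← hspan, Matrix.range_cons, Matrix.range_cons, Matrix.range_empty, Set.union_empty,
    Set.singleton_union, Submodule.mem_span_pair] at hpW
  obtain ⟨a, b, hab⟩ := hpW
  have ha : a ≠ 0 := by
    have := hφ ⟨p, hp⟩
    simpa [← hab, hφu, hφv] using this
  refine ⟨a, b / a, ha, ?_⟩
  rw [smul_add, smul_smul a (b / a), mul_div_cancel₀ _ ha, hab]

theorem linForm_add_smul_pow {K : Type} [Field K] {r d : ℕ} (u v : Fin (r + 1) → K) (x : K) :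
    linForm K r (u + x • v) ^ d = ∑ k ∈ Finset.range (d + 1),
      x ^ k • (linForm K r v ^ k * linForm K r u ^ (d - k) * (d.choose k : ℕ)) := by
  rw [map_add, map_smul, add_comm (linForm K r u), add_pow]
  refine Finset.sum_congr rfl fun k _ => ?_
  rw [smul_pow, smul_mul_assoc, smul_mul_assoc]

theorem infinite_setOf_card_eq_mem_decompSpan {K : Type} [Field K] [IsAlgClosed K] {r d : ℕ}
    {W : Submodule K (Fin (r + 1) → K)} (hW : Module.finrank K W = 2)
    {B : Finset (Projectivization K (Fin (r + 1) → K))} (hB : ∀ p ∈ B, p.rep ∈ W)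
    (hcard : d + 2 ≤ 2 * B.card) {g : MvPolynomial (Fin (r + 1)) K}
    (hg : g ∈ decompSpan K r d ↑B) :
    {E : Finset (Projectivization K (Fin (r + 1) → K)) |
      E.card = B.card ∧ g ∈ decompSpan K r d ↑E}.Infinite := by
  classical
  obtain ⟨u, v, hli, hpar⟩ := exists_affine_parametrization hW hB
    (Finset.card_pos.1 (by omega))
  choose! a b ha hab using hpar
  have hne : ∀ x : K, u + x • v ≠ 0 := fun x h0 => by
    have := LinearIndependent.pair_iff.1 hli 1 x (by simpa using h0)
    exact one_ne_zero this.1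
  let pt : K → Projectivization K (Fin (r + 1) → K) := fun x => Projectivization.mk K _ (hne x)
  have hpt : Function.Injective pt := fun x y hxy => by
    obtain ⟨c, hc⟩ := (Projectivization.mk_eq_mk_iff' K _ _ (hne x) (hne y)).1 hxy
    have := LinearIndependent.pair_iff.1 hli (c - 1) (c * y - x) (by
      rw [← sub_eq_zero.2 hc]
      module)
    have hc1 : c = 1 := sub_eq_zero.1 this.1
    simpa [hc1, sub_eq_zero, eq_comm] using this.2
  have hptb : ∀ p ∈ B, pt (b p) = p := fun p hp => by
    rw [← Projectivization.mk_rep p]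
    refine (Projectivization.mk_eq_mk_iff' K _ _ _ _).2 ⟨(a p)⁻¹, ?_⟩
    rw [Projectivization.mk_rep, hab p hp, inv_smul_smul₀ (ha p hp)]
  have hbinj : Set.InjOn b B := fun p hp q hq hpq => by
    rw [← hptb p hp, ← hptb q hq, hpq]
  have hbcard : (B.image b).card = B.card := Finset.card_image_of_injOn hbinj
  have hgspan : g ∈ Submodule.span K
      ((fun x : K => linForm K r (u + x • v) ^ d) '' (B.image b : Set K)) := by
    refine Submodule.span_le.2 ?_ hg
    rintro _ ⟨p, hp, rfl⟩
    rw [powForm_eq_linForm_pow, hab p hp, map_smul, smul_pow]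
    refine Submodule.smul_mem _ _ (Submodule.subset_span ⟨b p, ?_, rfl⟩)
    exact Finset.mem_coe.2 (Finset.mem_image_of_mem b hp)
  obtain ⟨c, hc⟩ := (Submodule.mem_span_image_finset_iff_exists_fun' K).1 hgspan
  have hsum : ∀ (Γ : Finset K) (w : K → K), ∑ x ∈ Γ, w x • linForm K r (u + x • v) ^ d =
      ∑ k ∈ Finset.range (d + 1), (∑ x ∈ Γ, w x * x ^ k) •
        (linForm K r v ^ k * linForm K r u ^ (d - k) * (d.choose k : ℕ)) := fun Γ w => by
    simp_rw [linForm_add_smul_pow, Finset.smul_sum, Finset.sum_smul, smul_smul]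
    exact Finset.sum_comm
  refine ((infinite_setOf_quadrature (B.image b) c d (by omega)).image
    (f := Finset.image pt) (Finset.image_injective hpt).injOn).mono ?_
  rintro _ ⟨Γ, ⟨hΓ, w, hw⟩, rfl⟩
  refine ⟨by rw [Finset.card_image_of_injective _ hpt, hΓ, hbcard], ?_⟩
  have hgΓ : g = ∑ x ∈ Γ, w x • linForm K r (u + x • v) ^ d := by
    rw [← hc, hsum, hsum]
    refine Finset.sum_congr rfl fun k hk => ?_
    rw [hw k (Nat.lt_succ_iff.1 (Finset.mem_range.1 hk))]
  rw [hgΓ]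
  refine Submodule.sum_mem _ fun x hx => Submodule.smul_mem _ _ ?_
  exact linForm_pow_mem_decompSpan (hne x) (Finset.mem_coe.2 (Finset.mem_image_of_mem pt hx))

/-- case (a) of Theorem 1.3: `A ∈ S(f)` meets a line `D = ℙ(W)` in
`n ≥ ⌈(d+2)/2⌉` points; with `F := A \ D`, the subspace
`span{ℓ^d : A ∩ D} ∩ span({f} ∪ {ℓ^d : F})` is one-dimensional; for any generator
`g` of it, `sr(g) = n`, `S(g)` is infinite, every `E ∈ S(g)` consists of forms in
`W` (hence is disjoint from `F`), and `E ∪ F` is a decomposition of `f`. -/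
theorem stmt_17 {K : Type} [Field K] [IsAlgClosed K] [CharZero K]
    {r d t : ℕ} (hr : 2 ≤ r) (hd : 3 ≤ d) (ht : 0 < t) (htd : 2 * t < 3 * d)
    {f : MvPolynomial (Fin (r + 1)) K} (hf0 : f ≠ 0) (hfh : f.IsHomogeneous d)
    (hsr : symRank K r d f = t)
    {A : Finset (Projectivization K (Fin (r + 1) → K))}
    (hA : A ∈ decompSet K r d f)
    {W : Submodule K (Fin (r + 1) → K)} (hW : Module.finrank K W = 2)
    {D : Set (Projectivization K (Fin (r + 1) → K))} (hD : D = {p | p.rep ∈ W})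
    (hn : (d + 3) / 2 ≤
      ((↑A : Set (Projectivization K (Fin (r + 1) → K))) ∩ D).ncard) :
    Module.finrank K
      ↥(decompSpan K r d ((↑A : Set (Projectivization K (Fin (r + 1) → K))) ∩ D)
        ⊓ Submodule.span K ({f} ∪ powForm K r d ''
            ((↑A : Set (Projectivization K (Fin (r + 1) → K))) \ D))) = 1
    ∧ ∀ g : MvPolynomial (Fin (r + 1)) K, g ≠ 0 →
        g ∈ decompSpan K r d ((↑A : Set (Projectivization K (Fin (r + 1) → K))) ∩ D)
          ⊓ Submodule.span K ({f} ∪ powForm K r d ''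
              ((↑A : Set (Projectivization K (Fin (r + 1) → K))) \ D)) →
        symRank K r d g
            = ((↑A : Set (Projectivization K (Fin (r + 1) → K))) ∩ D).ncard
        ∧ (decompSet K r d g).Infinite
        ∧ ∀ E ∈ decompSet K r d g,
            (∀ p ∈ E, p.rep ∈ W)
            ∧ Disjoint (↑E : Set (Projectivization K (Fin (r + 1) → K)))
                ((↑A : Set (Projectivization K (Fin (r + 1) → K))) \ D)
            ∧ f ∈ decompSpan K r d
                ((↑E : Set (Projectivization K (Fin (r + 1) → K))) ∪ (↑A \ D))
            ∧ ((↑E : Set (Projectivization K (Fin (r + 1) → K))) ∪ (↑A \ D)).ncard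
                = symRank K r d f := by
  classical
  subst hD
  set B := A.filter fun p => p.rep ∈ W with hBdef
  set F := A.filter fun p => ¬ p.rep ∈ W with hFdef
  have hB : (↑A : Set (Projectivization K (Fin (r + 1) → K))) ∩ {p | p.rep ∈ W} = ↑B := by
    ext p; simp [hBdef]
  have hF : (↑A : Set (Projectivization K (Fin (r + 1) → K))) \ {p | p.rep ∈ W} = ↑F := by
    ext p; simp [hFdef]
  rw [hB, hF]
  rw [hB] at hn
  rw [Set.ncard_coe_finset] at hn ⊢
  have hcard : B.card + F.card = symRank K r d f := by
    rw [← hA.2]; exact Finset.card_filter_add_card_filter_not _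
  have hBW : ∀ p ∈ B, p.rep ∈ W := fun p hp => (Finset.mem_filter.1 hp).2
  have hAeq : decompSpan K r d (A : Set (Projectivization K (Fin (r + 1) → K))) =
      decompSpan K r d ↑B ⊔ decompSpan K r d ↑F := by
    rw [decompSpan, decompSpan, decompSpan, ← Submodule.span_union, ← Set.image_union, ← hB,
      ← hF, Set.inter_union_sdiff]
  have hdisj : Disjoint (decompSpan K r d (B : Set (Projectivization K (Fin (r + 1) → K))))
      (decompSpan K r d ↑F) := by
    have hli := linearIndepOn_powForm_of_mem_decompSet hA
    have := LinearIndependent.disjoint_span_image hli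
      (s := {p | (p : Projectivization K (Fin (r + 1) → K)).rep ∈ W})
      (t := {p | ¬ (p : Projectivization K (Fin (r + 1) → K)).rep ∈ W})
      (Set.disjoint_left.2 fun _ h1 h2 => h2 h1)
    refine this.mono (Submodule.span_mono ?_) (Submodule.span_mono ?_)
    · rintro _ ⟨p, hp, rfl⟩
      exact ⟨⟨p, (Finset.mem_filter.1 hp).1⟩, (Finset.mem_filter.1 hp).2, rfl⟩
    · rintro _ ⟨p, hp, rfl⟩
      exact ⟨⟨p, (Finset.mem_filter.1 hp).1⟩, (Finset.mem_filter.1 hp).2, rfl⟩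
  obtain ⟨g₀, hg₀, h₀, hh₀, hfeq⟩ := Submodule.mem_sup.1 (hAeq ▸ hA.1)
  have hg₀0 : g₀ ≠ 0 := by
    rintro rfl
    rw [zero_add] at hfeq
    have := symRank_le_card (hfeq ▸ hh₀)
    omega
  have hcoef : ∀ g ∈ decompSpan K r d (B : Set (Projectivization K (Fin (r + 1) → K))) ⊓
      Submodule.span K ({f} ∪ powForm K r d '' ↑F), ∃ α : K, α • g₀ = g := by
    rintro g ⟨hgB, hgF⟩
    rw [SetLike.mem_coe, Submodule.span_union, Submodule.mem_sup] at hgF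
    obtain ⟨y, hy, h, hh, rfl⟩ := hgF
    obtain ⟨α, rfl⟩ := Submodule.mem_span_singleton.1 hy
    refine ⟨α, ?_⟩
    have hmem : α • f + h - α • g₀ = h + α • h₀ := by
      rw [← hfeq, smul_add]; abel
    have h1 := Submodule.sub_mem _ hgB (Submodule.smul_mem _ α hg₀)
    have h2 : α • f + h - α • g₀ ∈ decompSpan K r d
        (F : Set (Projectivization K (Fin (r + 1) → K))) := by
      rw [hmem]
      exact Submodule.add_mem _ hh (Submodule.smul_mem _ α hh₀)
    exact (sub_eq_zero.1 (Submodule.disjoint_def.1 hdisj _ h1 h2)).symm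
  refine ⟨finrank_eq_one_iff'.2 ⟨⟨g₀, hg₀, ?_⟩, ?_, ?_⟩, ?_⟩
  · rw [SetLike.mem_coe, eq_sub_of_add_eq hfeq, Submodule.span_union]
    exact Submodule.sub_mem _
      (Submodule.mem_sup_left (Submodule.mem_span_singleton_self f))
      (Submodule.mem_sup_right hh₀)
  · exact fun h => hg₀0 (congrArg Subtype.val h)
  · rintro ⟨g, hg⟩
    obtain ⟨α, hα⟩ := hcoef g hg
    exact ⟨α, Subtype.ext hα⟩
  intro g hg0 hg
  obtain ⟨α, hα⟩ := hcoef g hg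
  have hα0 : α ≠ 0 := by
    rintro rfl
    exact hg0 (by rw [← hα, zero_smul])
  have hunion : ∀ E : Finset (Projectivization K (Fin (r + 1) → K)),
      g ∈ decompSpan K r d ↑E → f ∈ decompSpan K r d ↑(E ∪ F) := fun E hgE => by
    rw [Finset.coe_union, decompSpan, Set.image_union, Submodule.span_union, ← hfeq]
    refine Submodule.add_mem _ (Submodule.mem_sup_left ?_) (Submodule.mem_sup_right hh₀)
    rw [← inv_smul_smul₀ hα0 g₀, hα]
    exact Submodule.smul_mem _ _ hgE
  have hrank : symRank K r d g = B.card := by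
    refine le_antisymm (symRank_le_card hg.1) ?_
    obtain ⟨E, hEcard, hE⟩ := exists_card_eq_symRank hg.1
    have h1 := symRank_le_card (hunion E hE)
    have h2 := Finset.card_union_le E F
    omega
  refine ⟨hrank, ?_, fun E hE => ?_⟩
  · refine (infinite_setOf_card_eq_mem_decompSpan hW hBW (by omega) hg.1).mono ?_
    rintro E ⟨hEcard, hE⟩
    exact ⟨hE, hEcard.trans hrank.symm⟩
  · have hEW : ∀ p ∈ E, p.rep ∈ W := fun p hp =>
      rep_mem_of_mem_decompSet (by omega)
        (Submodule.span_mono (Set.image_mono fun p hp => hBW p hp) hg.1) hE hp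
    have hEF : Disjoint E F := Finset.disjoint_left.2 fun p hpE hpF =>
      (Finset.mem_filter.1 hpF).2 (hEW p hpE)
    refine ⟨hEW, Finset.disjoint_coe.2 hEF, ?_, ?_⟩
    · rw [← Finset.coe_union]
      exact hunion E hE.1
    · rw [← Finset.coe_union, Set.ncard_coe_finset, Finset.card_union_of_disjoint hEF, hE.2,
        hrank, hcard]
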